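/- Let n ≥ 2 and let W be an n×n complex matrix with all entries nonzero such that ∑_{x} W x a / W x b = 0 for all a ≠ b in Fin n. Let ξ ∈ ℂ be nonzero, set d = −ξ² − ξ⁻², and assume d² = n. Let V⁺ be the Potts matrix on Fin n with parameter ξ and V⁻ its Hadamard inverse. Then: (i) V⁺ is symmetric; (ii) V⁺ x y · V⁻ x y = 1 for all x, y (type II condition); and (iii) for all a, b ∈ Fin n, V⁺.mulVec Y^W_{ab} = (d · V⁻ a b) • Y^W_{ab}. In other words, every matrix W whose vectors Y^W_{ab} (a ≠ b) have zero coordinate sum admits the Potts matrix as a type II refinement. -/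

import Mathlib

open Matrix BigOperators

/-- A matrix with constant diagonal `p` and constant off-diagonal entry `q` acts on vectors as
`(p - q) • v` plus `q` times the coordinate sum. -/
lemma mulVec_of_ite_eq {ι R : Type*} [Fintype ι] [DecidableEq ι] [CommRing R]
    (p q : R) (v : ι → R) (x : ι) :
    (Matrix.of fun a b : ι => if a = b then p else q).mulVec v x
      = (p - q) * v x + q * ∑ y, v y := by
  have h (y : ι) : (if x = y then p else q) * v y
      = (if x = y then (p - q) * v y else 0) + q * v y := by
    split_ifs <;> ring
  simp [Matrix.mulVec, dotProduct, h, Finset.sum_add_distrib, Finset.mul_sum]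

/-- Every matrix `W` whose vectors `Y^W_{ab}` (`a ≠ b`) have zero coordinate sum admits the
Potts matrix as a type II refinement. -/
theorem stmt5 (n : ℕ) (hn : 2 ≤ n) (W : Matrix (Fin n) (Fin n) ℂ)
    (hW : ∀ x y, W x y ≠ 0)
    (hsum : ∀ a b : Fin n, a ≠ b → ∑ x, W x a / W x b = 0)
    (ξ : ℂ) (hξ : ξ ≠ 0) (d : ℂ) (hd : d = -ξ ^ 2 - (ξ ^ 2)⁻¹) (hdn : d ^ 2 = n)
    (Vp Vm : Matrix (Fin n) (Fin n) ℂ)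
    (hVp : Vp = Matrix.of fun a b => if a = b then -(ξ ^ 3)⁻¹ else ξ)
    (hVm : Vm = Matrix.of fun a b => if a = b then -ξ ^ 3 else ξ⁻¹) :
    Vp.IsSymm ∧ (∀ x y, Vp x y * Vm x y = 1) ∧
    (∀ a b : Fin n, Vp.mulVec (fun x => W x a / W x b)
      = (d * Vm a b) • (fun x => W x a / W x b)) := by
  subst hVp hVm
  refine ⟨?_, fun x y => ?_, fun a b => ?_⟩
  · ext x y
    simp [eq_comm]
  · by_cases h : x = y <;> simp [h, hξ]
  · ext x
    rw [mulVec_of_ite_eq]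
    by_cases h : a = b
    · subst h
      simp only [div_self (hW _ a), Matrix.of_apply, if_true, Pi.smul_apply, smul_eq_mul,
        Finset.sum_const, Finset.card_univ, Fintype.card_fin, nsmul_eq_mul, mul_one]
      rw [← hdn, hd]
      field_simp
      ring
    · simp only [hsum a b h, Matrix.of_apply, if_neg h, Pi.smul_apply, smul_eq_mul, mul_zero,
        add_zero]
      congr 1
      rw [hd]
      field_simp
      ring
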